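/- The relation ≤_EPV on epistemic pair-views is a partial order: it is reflexive, transitive, and antisymmetric. -/

import Mathlib

namespace Gossip

/-- A call between two distinct agents. -/
structure Call (A : Type) where
  x : A
  y : A
  ne : x ≠ y

variable {A : Type} [DecidableEq A]

/-- Agent `a` is involved in the call `c`. -/
def Call.involves (c : Call A) (a : A) : Prop := a = c.x ∨ a = c.y

instance (c : Call A) (a : A) : Decidable (c.involves a) := by
  unfold Call.involves; infer_instance

/-- `c` is the call between agents `a` and `b`. -/
def Call.isBetween (c : Call A) (a b : A) : Prop :=
  (c.x = a ∧ c.y = b) ∨ (c.x = b ∧ c.y = a)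

instance (c : Call A) (a b : A) : Decidable (c.isBetween a b) := by
  unfold Call.isBetween; infer_instance

/-- The effect of a call on a gossip situation: the two agents involved
pool their secrets. -/
def Call.apply (c : Call A) (s : A → Finset A) : A → Finset A :=
  fun d => if d = c.x ∨ d = c.y then s c.x ∪ s c.y else s d

/-- The initial gossip situation: each agent is familiar only with their
own secret (secrets are identified with agents via the fixed bijection). -/
def root : A → Finset A := fun a => {a}

/-- The result of applying a call sequence to a gossip situation. -/
def applySeq (σ : List (Call A)) (s : A → Finset A) : A → Finset A :=
  σ.foldl (fun t c => c.apply t) s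

/-- `∼_a` : the smallest relation with `ε ∼_a ε`, closed under appending
calls not involving `a` on either side, and under appending a call
involving `a` on both sides when it yields the same set of secrets for `a`. -/
inductive AgEquiv (a : A) : List (Call A) → List (Call A) → Prop
  | nil : AgEquiv a [] []
  | extLeft {σ τ : List (Call A)} (c : Call A) :
      ¬ c.involves a → AgEquiv a σ τ → AgEquiv a (σ ++ [c]) τ
  | extRight {σ τ : List (Call A)} (c : Call A) :
      ¬ c.involves a → AgEquiv a σ τ → AgEquiv a σ (τ ++ [c])
  | call {σ τ : List (Call A)} (c : Call A) :
      c.involves a →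
      applySeq (σ ++ [c]) root a = applySeq (τ ++ [c]) root a →
      AgEquiv a σ τ → AgEquiv a (σ ++ [c]) (τ ++ [c])

/-- `∼_G` : reflexive-transitive closure of the union of the `∼_a`, `a ∈ G`. -/
def GEquiv (G : Finset A) : List (Call A) → List (Call A) → Prop :=
  Relation.ReflTransGen (fun σ τ => ∃ a ∈ G, AgEquiv a σ τ)

/-- Formulas of the language `L^ck`. `fam a p` is `F_a p`,
`ck G φ` is `C_G φ`; `K_a φ` is `ck {a} φ`. -/
inductive Formula (A : Type) where
  | fam : A → A → Formula A
  | neg : Formula A → Formula A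
  | conj : Formula A → Formula A → Formula A
  | ck : Finset A → Formula A → Formula A

/-- Truth of a formula at a call sequence (in the gossip model). -/
def Sat : Formula A → List (Call A) → Prop
  | .fam a p, σ => p ∈ applySeq σ root a
  | .neg φ, σ => ¬ Sat φ σ
  | .conj φ ψ, σ => Sat φ σ ∧ Sat ψ σ
  | .ck G φ, σ => ∀ τ, GEquiv G σ τ → Sat φ τ

/-- `M ⊨ φ` : truth at every call sequence. -/
def Truth (φ : Formula A) : Prop := ∀ σ : List (Call A), Sat φ σ

/-- Formulas with no occurrence of the negation symbol. -/
def NegFree : Formula A → Prop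
  | .fam _ _ => True
  | .neg _ => False
  | .conj φ ψ => NegFree φ ∧ NegFree ψ
  | .ck _ φ => NegFree φ

/-- Formulas with no occurrence of the `C_G` modalities (propositional part). -/
def CkFree : Formula A → Prop
  | .fam _ _ => True
  | .neg φ => CkFree φ
  | .conj φ ψ => CkFree φ ∧ CkFree ψ
  | .ck _ _ => False

/-- Formulas of `L_wn`: no nested occurrence of the `C_G` modalities. -/
def NoNested : Formula A → Prop
  | .fam _ _ => True
  | .neg φ => NoNested φ
  | .conj φ ψ => NoNested φ ∧ NoNested ψ
  | .ck _ φ => CkFree φ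

/-- The call `ab` occurs in `σ`. -/
def occursBetween (a b : A) (σ : List (Call A)) : Prop :=
  ∃ c ∈ σ, c.isBetween a b

/-- Epistemic pair-view component `Ṽ(σ)(a,b)`. -/
def pairView (σ : List (Call A)) (a b : A) : Set (A → Finset A) :=
  {s | ∃ τ, GEquiv {a, b} σ τ ∧ s = applySeq τ root}

/-- The full epistemic pair-view `Ṽ(σ)` : all components `Ṽ(σ)(a,b)`
together with the designated situation `Ṽ(σ)(*) = σ(root)`. -/
def fullView (σ : List (Call A)) : (A → A → Set (A → Finset A)) × (A → Finset A) :=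
  (pairView σ, applySeq σ root)

/-- A call sequence is pair-epistemically non-redundant if no nonempty
subsequence `σ₂` of a prefix `σ₁.σ₂` is pair-epistemically redundant. -/
def PairNonRedundant (σ : List (Call A)) : Prop :=
  ∀ σ₁ σ₂ : List (Call A), (σ₁ ++ σ₂) <+: σ → σ₂ ≠ [] →
    fullView σ₁ ≠ fullView (σ₁ ++ σ₂)

/-- Order on gossip situations: componentwise inclusion. -/
def gsLE (s t : A → Finset A) : Prop := ∀ a, s a ⊆ t a

/-- The order `≤_EPV` on (the pair components of) epistemic pair-views. -/
def epvLE (V W : A → A → Set (A → Finset A)) : Prop :=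
  ∀ a b : A, ∃ X : Set (A → Finset A), X ⊆ V a b ∧
    ∃ g : X → W a b, Function.Surjective g ∧ ∀ s : X, gsLE s.1 (g s).1

/-- `σ` is ab-redundant free: no call of `σ` different from the call `ab`
is redundant (leaves the current gossip situation unchanged). -/
def abRedundantFree (a b : A) (σ : List (Call A)) : Prop :=
  ∀ (i : ℕ) (h : i < σ.length), ¬ (σ.get ⟨i, h⟩).isBetween a b →
    (σ.get ⟨i, h⟩).apply (applySeq (σ.take i) root) ≠ applySeq (σ.take i) root

/-- `epvLE` rephrased: every component of `W` embeds injectively and deflationarily into the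
corresponding component of `V`. -/
theorem epvLE_iff_exists_injective {A : Type} {V W : A → A → Set (A → Finset A)} :
    epvLE V W ↔ ∀ a b, ∃ f : W a b → V a b, Function.Injective f ∧ ∀ t, (f t).1 ≤ t.1 := by
  refine forall₂_congr fun a b => ⟨?_, ?_⟩
  · rintro ⟨X, hX, g, hg, hle⟩
    refine ⟨fun t => Set.inclusion hX (Function.surjInv hg t),
      (Set.inclusion_injective hX).comp (Function.injective_surjInv hg), fun t => ?_⟩
    have h := hle (Function.surjInv hg t)
    rwa [Function.surjInv_eq hg t] at h
  · rintro ⟨f, hf, hle⟩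
    have hX (s : (Set.range fun t => (f t).1)) : ∃ t, (f t).1 = s.1 := s.2
    choose g hg using hX
    refine ⟨_, Set.range_subset_iff.2 fun t => (f t).2, g, fun t => ?_, fun s => ?_⟩
    · exact ⟨⟨_, t, rfl⟩, hf (Subtype.ext (hg _))⟩
    · exact (hg s).symm.trans_le (hle (g s))

/-- An injective deflationary self-map of a finite partial order is the identity. -/
theorem eq_of_injective_of_forall_le {α : Type*} [PartialOrder α] [Finite α] {f : α → α}
    (hf : Function.Injective f) (hle : ∀ x, f x ≤ x) (x : α) : f x = x := by
  obtain ⟨n, hn, hx⟩ := hf.mem_periodicPts x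
  obtain ⟨k, rfl⟩ := Nat.exists_eq_succ_of_ne_zero hn.ne'
  have hk : f^[k] (f x) = x := hx
  have hiter : f^[k] (f x) ≤ f x := Function.iterate_le_id_of_le_id hle k (f x)
  exact (hle x).antisymm (hk.symm.trans_le hiter)

/-- Finite sets that embed deflationarily into each other: the first lies in the second. -/
theorem subset_of_injective_of_forall_le {α : Type*} [PartialOrder α] {S T : Set α}
    (hS : S.Finite) {f : T → S} {g : S → T} (hf : Function.Injective f)
    (hg : Function.Injective g) (hfle : ∀ t, (f t).1 ≤ t.1) (hgle : ∀ s, (g s).1 ≤ s.1) :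
    S ⊆ T := by
  intro s hs
  have := hS.to_subtype
  have hid : f (g ⟨s, hs⟩) = ⟨s, hs⟩ :=
    eq_of_injective_of_forall_le (hf.comp hg) (fun x => (hfle (g x)).trans (hgle x)) _
  have hle : s ≤ (g ⟨s, hs⟩).1 := (congrArg Subtype.val hid).symm.trans_le (hfle _)
  have heq : s = (g ⟨s, hs⟩).1 := hle.antisymm (hgle ⟨s, hs⟩)
  rw [heq]
  exact (g ⟨s, hs⟩).2

theorem stmt17 {A : Type} [DecidableEq A] [Fintype A] (hA : 3 ≤ Fintype.card A) :
    Reflexive (epvLE (A := A)) ∧ Transitive (epvLE (A := A)) ∧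
    (∀ V W : A → A → Set (A → Finset A),
      (∀ a b, (V a b).Finite) → (∀ a b, (W a b).Finite) →
      epvLE V W → epvLE W V → V = W) := by
  refine ⟨fun V => ?_, fun V W U hVW hWU => ?_, fun V W hV hW hVW hWV => ?_⟩
  · exact epvLE_iff_exists_injective.2 fun a b => ⟨id, Function.injective_id, fun _ => le_rfl⟩
  · rw [epvLE_iff_exists_injective] at *
    intro a b
    obtain ⟨f, hf, hfle⟩ := hVW a b
    obtain ⟨g, hg, hgle⟩ := hWU a b
    exact ⟨f ∘ g, hf.comp hg, fun t => (hfle (g t)).trans (hgle t)⟩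
  · rw [epvLE_iff_exists_injective] at hVW hWV
    funext a b
    obtain ⟨f, hf, hfle⟩ := hVW a b
    obtain ⟨g, hg, hgle⟩ := hWV a b
    exact (subset_of_injective_of_forall_le (hV a b) hf hg hfle hgle).antisymm
      (subset_of_injective_of_forall_le (hW a b) hg hf hgle hfle)

end Gossip
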